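/- arXiv:1308.0747 — 11 statements merged into one kernel-verified Lean document; each statement's English description precedes it below -/
import Mathlib

section
/- Let n ≥ 1 and let Δ be a function from GL_n(R) to the n×n matrices over R such that for every integer m ≥ 1 and all a, b ∈ GL_n(R) with a ≡ b mod p^m one has Δ(a) ≡ Δ(b) mod p^m; set Φ(a) := a^(p) + p·Δ(a). Then for every u₀ ∈ GL_n(R) and every n×n matrix α over R there exists a unique u ∈ GL_n(R) such that u ≡ u₀ mod p and φ(u) = (1 + pα)·Φ(u) (equivalently, δu = α·Φ(u) + Δ(u)). -/
noncomputable section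

/-- `R = W(k)`, `k` the algebraic closure of `𝔽_p`. -/
abbrev Rp (p : ℕ) [Fact p.Prime] : Type _ :=
  WittVector p (AlgebraicClosure (ZMod p))

/-- `φ`, the unique Frobenius lift on `R`. -/
abbrev frobW (p : ℕ) [Fact p.Prime] : Rp p →+* Rp p :=
  WittVector.frobenius

/-- A congruence modulo `p ^ m` with `m ≥ 1` improves by one power of `p` under `p`-th powers. -/
theorem pow_succ_dvd_pow_sub_pow {R : Type*} [CommRing R] {p m : ℕ} (hm : 1 ≤ m) {a b : R}
    (h : (p : R) ^ m ∣ a - b) : (p : R) ^ (m + 1) ∣ a ^ p - b ^ p := by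
  obtain ⟨c, hc⟩ := h
  obtain ⟨e, he⟩ := Polynomial.powAddExpansion b ((p : R) ^ m * c) p
  have hab : a = b + (p : R) ^ m * c := by rw [← hc]; ring
  obtain ⟨k, rfl⟩ := Nat.exists_eq_add_of_le hm
  rw [hab, he]
  exact ⟨b ^ (p - 1) * c + e * (p : R) ^ k * c ^ 2, by ring⟩

/-- A square matrix congruent to an invertible one modulo an element of the Jacobson radical is
invertible. -/
theorem Matrix.isUnit_of_dvd_sub {R ι : Type*} [CommRing R] [Fintype ι] [DecidableEq ι] {x : R}
    (hx : x ∈ (⊥ : Ideal R).jacobson) {a b : Matrix ι ι R} (hb : IsUnit b)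
    (h : ∀ i j, x ∣ a i j - b i j) : IsUnit a := by
  rw [Matrix.isUnit_iff_isUnit_det] at hb ⊢
  have hmap : (Ideal.Quotient.mk (Ideal.span {x})).mapMatrix a =
      (Ideal.Quotient.mk (Ideal.span {x})).mapMatrix b := by
    ext i j
    exact Ideal.Quotient.eq.2 (Ideal.mem_span_singleton.2 (h i j))
  have hdet := congrArg Matrix.det hmap
  rw [← RingHom.map_det, ← RingHom.map_det, Ideal.Quotient.eq, Ideal.mem_span_singleton] at hdet
  obtain ⟨c, hc⟩ := hdet
  obtain ⟨v, hv⟩ := hb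
  have hfactor : a.det = v * (x * (c * ↑v⁻¹) + 1) := by
    have : (v : R) * (↑v⁻¹ : R) = 1 := v.mul_inv
    rw [← hv] at hc
    linear_combination hc - x * c * this
  rw [hfactor]
  exact v.isUnit.mul (Ideal.mem_jacobson_bot.1 hx _)

/-- A fixed point theorem: over an `x`-adically complete ring, a map which preserves the residue
class of `u₀` modulo `x` and is contracting on it has a unique fixed point in that class. -/
theorem Matrix.existsUnique_fixedPoint_of_adic_contraction {R ι κ : Type*} [CommRing R] (x : R)
    [IsAdicComplete (Ideal.span {x}) R] (F : Matrix ι κ R → Matrix ι κ R) (u₀ : Matrix ι κ R)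
    (hmaps : ∀ u : Matrix ι κ R, (∀ i j, x ∣ u i j - u₀ i j) → ∀ i j, x ∣ F u i j - u₀ i j)
    (hcontr : ∀ m : ℕ, 1 ≤ m → ∀ a b : Matrix ι κ R, (∀ i j, x ∣ a i j - u₀ i j) →
      (∀ i j, x ∣ b i j - u₀ i j) → (∀ i j, x ^ m ∣ a i j - b i j) →
      ∀ i j, x ^ (m + 1) ∣ F a i j - F b i j) :
    ∃! u : Matrix ι κ R, (∀ i j, x ∣ u i j - u₀ i j) ∧ F u = u := by
  have hsep : ∀ a b : Matrix ι κ R, (∀ m : ℕ, ∀ i j, x ^ (m + 1) ∣ a i j - b i j) → a = b := by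
    intro a b h
    ext i j
    rw [IsHausdorff.eq_iff_smodEq (I := Ideal.span {x})]
    intro m
    rw [SModEq.sub_mem, smul_eq_mul, Ideal.mul_top, Ideal.span_singleton_pow,
      Ideal.mem_span_singleton]
    exact (pow_dvd_pow x m.le_succ).trans (h m i j)
  have hiter : ∀ m i j, x ∣ F^[m] u₀ i j - u₀ i j := by
    intro m
    induction m with
    | zero => simp
    | succ m ih => rw [Function.iterate_succ_apply']; exact hmaps _ ih
  have hstep : ∀ m i j, x ^ (m + 1) ∣ F^[m + 1] u₀ i j - F^[m] u₀ i j := by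
    intro m
    induction m with
    | zero => simpa using hiter 1
    | succ m ih =>
      rw [Function.iterate_succ_apply' F (m + 1), Function.iterate_succ_apply' F m]
      rw [Function.iterate_succ_apply'] at ih
      exact hcontr (m + 1) (by omega) _ _
        (by simpa only [Function.iterate_succ_apply'] using hiter (m + 1)) (hiter m) ih
  have hcauchy : ∀ i j m d, x ^ m ∣ F^[m] u₀ i j - F^[m + d] u₀ i j := by
    intro i j m d
    induction d with
    | zero => simp
    | succ d ih =>
      have hnext : x ^ m ∣ F^[m + d + 1] u₀ i j - F^[m + d] u₀ i j :=
        (pow_dvd_pow x (by omega)).trans (hstep (m + d) i j)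
      simpa [add_assoc] using dvd_sub ih hnext
  have hlim : ∀ i j, ∃ L : R, ∀ m, x ^ m ∣ F^[m] u₀ i j - L := by
    intro i j
    obtain ⟨L, hL⟩ := IsPrecomplete.prec' (I := Ideal.span {x}) (fun m ↦ F^[m] u₀ i j) (by
      intro m l hml
      obtain ⟨d, rfl⟩ := Nat.exists_eq_add_of_le hml
      rw [SModEq.sub_mem, smul_eq_mul, Ideal.mul_top, Ideal.span_singleton_pow,
        Ideal.mem_span_singleton]
      exact hcauchy i j m d)
    refine ⟨L, fun m ↦ ?_⟩
    have := hL m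
    rwa [SModEq.sub_mem, smul_eq_mul, Ideal.mul_top, Ideal.span_singleton_pow,
      Ideal.mem_span_singleton] at this
  choose L hL using hlim
  have hL₀ : ∀ i j, x ∣ L i j - u₀ i j := by
    intro i j
    have h := hL i j 1
    rw [pow_one] at h
    simpa only [sub_sub_sub_cancel_left] using dvd_sub (hiter 1 i j) h
  have hfix : F L = L := hsep _ _ fun m i j ↦ by
    have hF := hcontr (m + 1) (by omega) _ L (hiter (m + 1)) hL₀ (fun i j ↦ hL i j (m + 1)) i j
    rw [← Function.iterate_succ_apply' F] at hF
    simpa using (pow_dvd_pow x (m + 1).le_succ).trans (dvd_sub (hL i j (m + 2)) hF)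
  refine ⟨L, ⟨hL₀, hfix⟩, ?_⟩
  rintro v ⟨hv₀, hv⟩
  refine hsep _ _ fun m ↦ ?_
  induction m with
  | zero =>
    intro i j
    simpa using dvd_sub (hv₀ i j) (hL₀ i j)
  | succ m ih =>
    have := hcontr (m + 1) (by omega) v L hv₀ hL₀ ih
    rwa [hv, hfix] at this

/-- existence and uniqueness of solutions of the `Δ`-linear equation
`φ(u) = (1 + pα)·(u^(p) + p·Δ(u))` with prescribed reduction mod `p`. -/
theorem statement0 {p : ℕ} [Fact p.Prime] (hp2 : p ≠ 2)
    (δ : Rp p → Rp p) (hδ : ∀ a, frobW p a = a ^ p + p * δ a)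
    (n : ℕ) (hn : 1 ≤ n)
    (Δ : Matrix (Fin n) (Fin n) (Rp p) → Matrix (Fin n) (Fin n) (Rp p))
    (hΔ : ∀ m : ℕ, 1 ≤ m → ∀ a b : Matrix (Fin n) (Fin n) (Rp p),
      IsUnit a → IsUnit b → (∀ i j, (p : Rp p) ^ m ∣ (a i j - b i j)) →
      ∀ i j, (p : Rp p) ^ m ∣ (Δ a i j - Δ b i j))
    (u₀ : Matrix (Fin n) (Fin n) (Rp p)) (hu₀ : IsUnit u₀)
    (α : Matrix (Fin n) (Fin n) (Rp p)) :
    ∃! u : Matrix (Fin n) (Fin n) (Rp p),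
      IsUnit u ∧ (∀ i j, (p : Rp p) ∣ (u i j - u₀ i j)) ∧
        u.map (frobW p) =
          (1 + (p : Rp p) • α) * (u.map (· ^ p) + (p : Rp p) • Δ u) := by
  have hjac : (p : Rp p) ∈ (⊥ : Ideal (Rp p)).jacobson :=
    IsAdicComplete.le_jacobson_bot (Ideal.span {(p : Rp p)}) (Ideal.mem_span_singleton_self _)
  have hunit : ∀ u : Matrix (Fin n) (Fin n) (Rp p),
      (∀ i j, (p : Rp p) ∣ u i j - u₀ i j) → IsUnit u :=
    fun u hu ↦ Matrix.isUnit_of_dvd_sub hjac hu₀ hu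
  let σ : Rp p ≃+* Rp p := (WittVector.frobeniusEquiv p (AlgebraicClosure (ZMod p))).symm
  have hσ : ∀ a, σ (frobW p a) = a :=
    (WittVector.frobeniusEquiv p (AlgebraicClosure (ZMod p))).symm_apply_apply
  have hσ' : ∀ a, frobW p (σ a) = a :=
    (WittVector.frobeniusEquiv p (AlgebraicClosure (ZMod p))).apply_symm_apply
  have hσdvd : ∀ (m : ℕ) (a b : Rp p), (p : Rp p) ^ m ∣ a - b → (p : Rp p) ^ m ∣ σ a - σ b := by
    intro m a b h
    simpa using map_dvd σ h
  let G : Matrix (Fin n) (Fin n) (Rp p) → Matrix (Fin n) (Fin n) (Rp p) := fun u ↦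
    (1 + (p : Rp p) • α) * (u.map (· ^ p) + (p : Rp p) • Δ u)
  have hG : ∀ u i j, (p : Rp p) ∣ frobW p (u i j) - G u i j := by
    intro u i j
    have hexp : G u = u.map (· ^ p) +
        (p : Rp p) • (Δ u + α * (u.map (· ^ p) + (p : Rp p) • Δ u)) := by
      simp only [G, add_mul, one_mul, Matrix.smul_mul, smul_add]
      abel
    rw [hexp, hδ, Matrix.add_apply, Matrix.smul_apply, Matrix.map_apply, smul_eq_mul,
      add_sub_add_left_eq_sub, ← mul_sub]
    exact dvd_mul_right _ _
  have hGcontr : ∀ m : ℕ, 1 ≤ m → ∀ a b : Matrix (Fin n) (Fin n) (Rp p),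
      IsUnit a → IsUnit b → (∀ i j, (p : Rp p) ^ m ∣ a i j - b i j) →
      ∀ i j, (p : Rp p) ^ (m + 1) ∣ G a i j - G b i j := by
    intro m hm a b ha hb hab i j
    rw [← Matrix.sub_apply]
    simp only [G]
    rw [← mul_sub, Matrix.mul_apply]
    refine Finset.dvd_sum fun l _ ↦ Dvd.dvd.mul_left ?_ _
    have hsplit : (a.map (· ^ p) + (p : Rp p) • Δ a - (b.map (· ^ p) + (p : Rp p) • Δ b)) l j =
        (a l j ^ p - b l j ^ p) + p * (Δ a l j - Δ b l j) := by
      simp only [Matrix.sub_apply, Matrix.add_apply, Matrix.map_apply, Matrix.smul_apply,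
        smul_eq_mul]
      ring
    rw [hsplit]
    refine dvd_add (pow_succ_dvd_pow_sub_pow hm (hab l j)) ?_
    rw [pow_succ']
    exact mul_dvd_mul_left _ (hΔ m hm a b ha hb hab l j)
  have hfixed : ∀ u : Matrix (Fin n) (Fin n) (Rp p),
      u.map (frobW p) = G u ↔ (G u).map σ = u := by
    intro u
    constructor
    · intro h
      rw [← h]
      ext1 i j
      exact hσ _
    · intro h
      ext1 i j
      have hij : σ (G u i j) = u i j := congrFun (congrFun h i) j
      rw [Matrix.map_apply, ← hij, hσ']
  obtain ⟨u, ⟨hu, huG⟩, huniq⟩ := Matrix.existsUnique_fixedPoint_of_adic_contraction (p : Rp p)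
    (fun u ↦ (G u).map σ) u₀
    (fun u hu i j ↦ by
      have h := hσdvd 1 _ _ (by simpa using hG u i j)
      rw [hσ, pow_one] at h
      simpa using dvd_sub (hu i j) h)
    (fun m hm a b ha hb hab i j ↦
      hσdvd _ _ _ (hGcontr m hm a b (hunit a ha) (hunit b hb) hab i j))
  exact ⟨u, ⟨hunit u hu, hu, (hfixed u).2 huG⟩,
    fun v ⟨_, hv, hvG⟩ ↦ huniq v ⟨hv, (hfixed v).1 hvG⟩⟩
end
end

section
/- Let n ≥ 1 with p ∤ n. Let α be an n×n matrix over R with det(1 + pα) = 1, let u₀ ∈ GL_n(R) with det(u₀) = 1, and suppose u ∈ GL_n(R) and λ_u ∈ R satisfy: λ_u ≡ 1 mod p, λ_u^n · det(u^(p)) = det(u)^p, φ(u) = λ_u·(1+pα)·u^(p), and u ≡ u₀ mod p. Then det(u) = 1; i.e., solutions of the δ-linear equation of type SL_n with initial condition in SL_n(R) and with 1+pα ∈ SL_n(R) lie in SL_n(R). -/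
noncomputable section

/-- A Witt vector fixed by the `δ`-structure (`φ x = x ^ p`) and congruent to `1` modulo `p`
is equal to `1`. -/
theorem WittVector.eq_one_of_frobenius_eq_pow {p : ℕ} [Fact p.Prime] {k : Type*} [Field k]
    [CharP k p] [PerfectRing k p] {x : WittVector p k} (hx : WittVector.frobenius x = x ^ p)
    (h1 : (p : WittVector p k) ∣ x - 1) : x = 1 := by
  have hiter (m : ℕ) : WittVector.frobenius^[m] x = x ^ p ^ m := by
    induction m with
    | zero => simp
    | succ m ih => rw [Function.iterate_succ_apply', ih, map_pow, hx, ← pow_mul, pow_succ']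
  rw [← sub_eq_zero]
  ext m
  have hdvd : (p : WittVector p k) ^ (m + 1) ∣ WittVector.frobenius^[m] (x - 1) := by
    rw [iterate_map_sub, hiter, iterate_map_one]
    simpa using dvd_sub_pow_of_dvd_sub h1 m
  have hcoeff := (WittVector.mem_span_p_pow_iff_le_coeff_eq_zero _ (m + 1)).1
    (Ideal.mem_span_singleton.2 hdvd) m m.lt_succ_self
  rw [WittVector.iterate_frobenius_coeff] at hcoeff
  simpa using eq_zero_of_pow_eq_zero hcoeff

/-- Entrywise congruent matrices have congruent determinants. -/
theorem Matrix.dvd_det_sub_det {ι R : Type*} [Fintype ι] [DecidableEq ι] [CommRing R] {a : R}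
    {A B : Matrix ι ι R} (h : ∀ i j, a ∣ A i j - B i j) : a ∣ A.det - B.det := by
  rw [← Ideal.mem_span_singleton, ← Ideal.Quotient.eq, RingHom.map_det, RingHom.map_det]
  congr 1
  ext i j
  exact Ideal.Quotient.eq.2 (Ideal.mem_span_singleton.2 (h i j))

/-- solutions of the `δ`-linear equation of type `SL_n` with initial
condition in `SL_n(R)` and `1 + pα ∈ SL_n(R)` lie in `SL_n(R)`. -/
theorem statement2 {p : ℕ} [Fact p.Prime] (hp2 : p ≠ 2)
    (n : ℕ) (hn : 1 ≤ n) (hpn : ¬ (p ∣ n))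
    (α : Matrix (Fin n) (Fin n) (Rp p))
    (hα : (1 + (p : Rp p) • α).det = 1)
    (u₀ : Matrix (Fin n) (Fin n) (Rp p)) (hu₀ : IsUnit u₀) (hdet₀ : u₀.det = 1)
    (u : Matrix (Fin n) (Fin n) (Rp p)) (hu : IsUnit u)
    (lam : Rp p) (hlam1 : (p : Rp p) ∣ (lam - 1))
    (hlam : lam ^ n * (u.map (· ^ p)).det = u.det ^ p)
    (heq : u.map (frobW p) = lam • ((1 + (p : Rp p) • α) * u.map (· ^ p)))
    (hcong : ∀ i j, (p : Rp p) ∣ (u i j - u₀ i j)) :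
    u.det = 1 := by
  refine WittVector.eq_one_of_frobenius_eq_pow ?_ (hdet₀ ▸ Matrix.dvd_det_sub_det hcong)
  rw [← hlam, RingHom.map_det, RingHom.mapMatrix_apply, heq, Matrix.det_smul, Matrix.det_mul, hα,
    one_mul, Fintype.card_fin]
end
end

section
/- Let n ≥ 1, let q ∈ GL_n(R) be a matrix all of whose entries lie in R^δ, and let α be an n×n matrix over R with (1+pα)ᵗ·q·(1+pα) = q. Let u₀ ∈ GL_n(R) with u₀ᵗ·q·u₀ = q. Suppose u ∈ GL_n(R) and an n×n matrix Φu over R satisfy Φuᵗ·q·Φu = (uᵗ·q·u)^(p), φ(u) = (1+pα)·Φu, and u ≡ u₀ mod p. Then uᵗ·q·u = q; i.e., solutions of the δ-linear equation of type SO(q) with initial condition satisfying the q-orthogonality relation again satisfy it. -/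
noncomputable section

open Matrix

/-- An element of `W(k)` is divisible by `p` iff its constant coefficient vanishes. -/
theorem p_dvd_iff_constantCoeff_eq_zero {p : ℕ} [Fact p.Prime] (x : Rp p) :
    (p : Rp p) ∣ x ↔ WittVector.constantCoeff x = 0 := by
  rw [← Ideal.mem_span_singleton, WittVector.mem_span_p_iff_coeff_zero_eq_zero]
  rfl

theorem constantCoeff_frobW {p : ℕ} [Fact p.Prime] (x : Rp p) :
    WittVector.constantCoeff (frobW p x) = WittVector.constantCoeff x ^ p :=
  WittVector.coeff_frobenius_charP (p := p) x 0

theorem iterate_frobW_eq_pow {p : ℕ} [Fact p.Prime] {a : Rp p}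
    (ha : frobW p a = a ^ p) (m : ℕ) : (frobW p)^[m] a = a ^ p ^ m := by
  induction m with
  | zero => simp
  | succ m ih => rw [Function.iterate_succ_apply', ih, map_pow, ha, ← pow_mul, pow_succ']

/-- Reduction modulo `p` is injective on the `δ`-constants. -/
theorem eq_of_frobW_eq_pow_of_p_dvd_sub {p : ℕ} [Fact p.Prime] {a b : Rp p}
    (ha : frobW p a = a ^ p) (hb : frobW p b = b ^ p) (h : (p : Rp p) ∣ a - b) : a = b := by
  rw [← sub_eq_zero]
  ext m
  have hdvd : (p : Rp p) ^ (m + 1) ∣ (frobW p)^[m] (a - b) := by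
    rw [iterate_map_sub, iterate_frobW_eq_pow ha, iterate_frobW_eq_pow hb]
    exact dvd_sub_pow_of_dvd_sub h m
  rw [← Ideal.mem_span_singleton, WittVector.mem_span_p_pow_iff_le_coeff_eq_zero] at hdvd
  have hm := hdvd m m.lt_succ_self
  rw [WittVector.iterate_frobenius_coeff] at hm
  rw [WittVector.zero_coeff]
  exact eq_zero_of_pow_eq_zero hm

/-- solutions of the `δ`-linear equation of type `SO(q)` with initial
condition satisfying the `q`-orthogonality relation again satisfy it. -/
theorem statement3 {p : ℕ} [Fact p.Prime] (hp2 : p ≠ 2)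
    (δ : Rp p → Rp p) (hδ : ∀ a, frobW p a = a ^ p + p * δ a)
    (n : ℕ) (hn : 1 ≤ n)
    (q : Matrix (Fin n) (Fin n) (Rp p)) (hq : IsUnit q)
    (hqδ : ∀ i j, δ (q i j) = 0)
    (α : Matrix (Fin n) (Fin n) (Rp p))
    (hα : (1 + (p : Rp p) • α)ᵀ * q * (1 + (p : Rp p) • α) = q)
    (u₀ : Matrix (Fin n) (Fin n) (Rp p)) (hu₀ : IsUnit u₀)
    (hu₀q : u₀ᵀ * q * u₀ = q)
    (u : Matrix (Fin n) (Fin n) (Rp p)) (hu : IsUnit u)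
    (Φu : Matrix (Fin n) (Fin n) (Rp p))
    (hΦu : Φuᵀ * q * Φu = (uᵀ * q * u).map (· ^ p))
    (heq : u.map (frobW p) = (1 + (p : Rp p) • α) * Φu)
    (hcong : ∀ i j, (p : Rp p) ∣ (u i j - u₀ i j)) :
    uᵀ * q * u = q := by
  set c : Rp p →+* AlgebraicClosure (ZMod p) := WittVector.constantCoeff
  have hcp : c (p : Rp p) = 0 := (p_dvd_iff_constantCoeff_eq_zero _).1 dvd_rfl
  have hqpow (i j) : frobW p (q i j) = q i j ^ p := by rw [hδ, hqδ, mul_zero, add_zero]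
  set F := frobenius (AlgebraicClosure (ZMod p)) p
  have hΦmod : Φu.map c = (u.map c).map F := by
    have h := congrArg (fun M => M.map c) heq
    have h1 : (1 + (p : Rp p) • α).map c = 1 := by
      ext i j
      simp [Matrix.one_apply, hcp, apply_ite c]
    simp only [Matrix.map_mul, h1, one_mul] at h
    rw [← h]
    ext i j
    exact constantCoeff_frobW _
  have hqmod : q.map c = (q.map c).map F := by
    have hU : IsUnit ((u.map c).map F) :=
      (hu.map c.mapMatrix).map F.mapMatrix
    have hUt : IsUnit ((u.map c).map F)ᵀ := (Matrix.isUnit_transpose _).2 hU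
    have h := congrArg (fun M => M.map c) hΦu
    have hr : ((uᵀ * q * u).map (· ^ p)).map c = ((uᵀ * q * u).map c).map F := by
      ext i j
      exact map_pow c _ p
    simp only [hr, Matrix.map_mul, Matrix.transpose_map, hΦmod] at h
    exact hUt.mul_left_cancel (hU.mul_right_cancel h)
  have hqfix : q.map (frobW p) = q := by
    ext1 i j
    rw [Matrix.map_apply, hqpow]
    refine eq_of_frobW_eq_pow_of_p_dvd_sub (by rw [map_pow, hqpow]) (hqpow i j) ?_
    rw [p_dvd_iff_constantCoeff_eq_zero, map_sub, map_pow, sub_eq_zero]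
    exact (congrFun (congrFun hqmod i) j).symm
  have hb : (uᵀ * q * u).map (frobW p) = (uᵀ * q * u).map (· ^ p) := by
    rw [Matrix.map_mul, Matrix.map_mul, hqfix, Matrix.transpose_map, heq, ← hΦu,
      Matrix.transpose_mul]
    conv_rhs => rw [← hα]
    simp only [Matrix.mul_assoc]
  have humod : u.map c = u₀.map c := by
    ext i j
    have h := (p_dvd_iff_constantCoeff_eq_zero _).1 (hcong i j)
    rwa [map_sub, sub_eq_zero] at h
  have hbmod : (uᵀ * q * u).map c = q.map c := by
    have h := congrArg (fun M => M.map c) hu₀q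
    simpa only [Matrix.map_mul, Matrix.transpose_map, humod] using h
  ext1 i j
  refine eq_of_frobW_eq_pow_of_p_dvd_sub (congrFun (congrFun hb i) j) (hqpow i j) ?_
  rw [p_dvd_iff_constantCoeff_eq_zero, map_sub, sub_eq_zero]
  exact congrFun (congrFun hbmod i) j
end
end

section
/- Let n ≥ 1 with p ∤ n, let u ∈ GL_n(R), let λ_u ∈ R satisfy λ_u^n · det(u^(p)) = det(u)^p, and let α be an n×n matrix over R with det(1+pα) = 1. If φ(u) = λ_u·(1+pα)·u^(p), then φ(det u) = (det u)^p, i.e., δ(det u) = 0: the determinant is a prime integral of the δ-linear equation of type SL_n when 1+pα ∈ SL_n(R). -/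
noncomputable section

open Matrix

/-- the determinant is a prime integral of the `δ`-linear equation of
type `SL_n` when `1 + pα ∈ SL_n(R)`: `φ(det u) = (det u)^p`, i.e. `δ(det u) = 0`. -/
theorem statement4 {p : ℕ} [Fact p.Prime] (hp2 : p ≠ 2)
    (n : ℕ) (hn : 1 ≤ n) (hpn : ¬ (p ∣ n))
    (u : Matrix (Fin n) (Fin n) (Rp p)) (hu : IsUnit u)
    (lam : Rp p) (hlam : lam ^ n * (u.map (· ^ p)).det = u.det ^ p)
    (α : Matrix (Fin n) (Fin n) (Rp p))
    (hα : (1 + (p : Rp p) • α).det = 1)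
    (heq : u.map (frobW p) = lam • ((1 + (p : Rp p) • α) * u.map (· ^ p))) :
    frobW p u.det = u.det ^ p := by
  rw [RingHom.map_det, RingHom.mapMatrix_apply, heq, det_smul, det_mul, hα, one_mul,
    Fintype.card_fin, hlam]
end
end

section
/- Let n ≥ 1 with p ∤ n and let u, v ∈ GL_n(R). Suppose λ_u, λ_{uv} ∈ R satisfy λ_u ≡ 1 mod p, λ_u^n·det(u^(p)) = det(u)^p, λ_{uv} ≡ 1 mod p, λ_{uv}^n·det((uv)^(p)) = det(uv)^p, and suppose λ_{uv}·(uv)^(p) = λ_u·u^(p)·φ(v). Then φ(det v) = (det v)^p, i.e., δ(det v) = 0: the determinant is a prime integral of the equation φ(v) = Φ(u)⁻¹Φ(uv) for Φ of type SL_n. -/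
noncomputable section

open Matrix

/-- the determinant is a prime integral of the equation
`φ(v) = Φ(u)⁻¹ Φ(uv)` for `Φ` of type `SL_n`. -/
theorem statement7 {p : ℕ} [Fact p.Prime] (hp2 : p ≠ 2)
    (n : ℕ) (hn : 1 ≤ n) (hpn : ¬ (p ∣ n))
    (u v : Matrix (Fin n) (Fin n) (Rp p)) (hu : IsUnit u) (hv : IsUnit v)
    (lamu lamuv : Rp p)
    (hlamu1 : (p : Rp p) ∣ (lamu - 1))
    (hlamu : lamu ^ n * (u.map (· ^ p)).det = u.det ^ p)
    (hlamuv1 : (p : Rp p) ∣ (lamuv - 1))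
    (hlamuv : lamuv ^ n * ((u * v).map (· ^ p)).det = (u * v).det ^ p)
    (heq : lamuv • ((u * v).map (· ^ p)) =
      lamu • (u.map (· ^ p) * v.map (frobW p))) :
    frobW p v.det = v.det ^ p := by
  have h := congrArg Matrix.det heq
  rw [det_smul, det_smul, det_mul, Fintype.card_fin, hlamuv, ← mul_assoc, hlamu, det_mul,
    mul_pow] at h
  have hmap : (v.map (frobW p)).det = frobW p v.det := ((frobW p).map_det v).symm
  rw [hmap] at h
  exact (((isUnit_iff_isUnit_det u).mp hu).pow p).mul_left_cancel h.symm
end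
end

section
/- Let n ≥ 1, let q ∈ GL_n(R) with q^(p) = q, and let u ∈ GL_n(R) with uᵗ·q·u = q. Let Φ be a function from GL_n(R) to n×n matrices over R such that Φ(a)ᵗ·q·Φ(a) = (aᵗ·q·a)^(p) for all a ∈ GL_n(R) and such that Φ(u) is invertible. If v ∈ GL_n(R) satisfies φ(v) = Φ(u)⁻¹·Φ(u·v), then φ(vᵗ·q·v) = (vᵗ·q·v)^(p), i.e., δ(vᵗ q v) = 0: x ↦ xᵗqx is a prime integral of the equation φ(v) = Φ(u)⁻¹Φ(uv) for Φ of type SO(q). -/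
noncomputable section

open Matrix

/-- The Frobenius lift fixes every `a ∈ R` with `a ^ p = a`. -/
theorem frobW_eq_self_of_pow_eq_self {p : ℕ} [Fact p.Prime] {a : Rp p} (ha : a ^ p = a) :
    frobW p a = a := by
  have ha0 : a.coeff 0 ^ p = a.coeff 0 := by
    have h := congrArg WittVector.constantCoeff ha
    rwa [map_pow] at h
  have hdvd : (p : Rp p) ∣ frobW p a - a := by
    rw [← Ideal.mem_span_singleton, WittVector.mem_span_p_iff_coeff_zero_eq_zero]
    change WittVector.constantCoeff (frobW p a - a) = 0
    rw [map_sub, sub_eq_zero]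
    change (WittVector.frobenius a).coeff 0 = a.coeff 0
    rw [WittVector.coeff_frobenius_charP, ha0]
  have pow_eq_self {b : Rp p} (hb : b ^ p = b) (k : ℕ) : b ^ p ^ k = b := by
    induction k with
    | zero => simp
    | succ k ih => rw [pow_succ, pow_mul, ih, hb]
  by_contra hne
  obtain ⟨k, hk⟩ := FiniteMultiplicity.of_not_isUnit
    (WittVector.irreducible p (k := AlgebraicClosure (ZMod p))).not_isUnit (sub_ne_zero.2 hne)
  refine hk ?_
  have h := dvd_sub_pow_of_dvd_sub hdvd k
  rwa [pow_eq_self (by rw [← map_pow, ha]), pow_eq_self ha] at h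

/-- `x ↦ xᵗqx` is a prime integral of the equation
`φ(v) = Φ(u)⁻¹ Φ(uv)` for `Φ` of type `SO(q)`. -/
theorem statement8 {p : ℕ} [Fact p.Prime] (hp2 : p ≠ 2)
    (n : ℕ) (hn : 1 ≤ n)
    (q : Matrix (Fin n) (Fin n) (Rp p)) (hq : IsUnit q)
    (hqp : q.map (· ^ p) = q)
    (u : Matrix (Fin n) (Fin n) (Rp p)) (hu : IsUnit u)
    (huq : uᵀ * q * u = q)
    (Φ : Matrix (Fin n) (Fin n) (Rp p) → Matrix (Fin n) (Fin n) (Rp p))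
    (hΦ : ∀ a : Matrix (Fin n) (Fin n) (Rp p), IsUnit a →
      (Φ a)ᵀ * q * (Φ a) = (aᵀ * q * a).map (· ^ p))
    (hΦu : IsUnit (Φ u))
    (v : Matrix (Fin n) (Fin n) (Rp p)) (hv : IsUnit v)
    (heq : v.map (frobW p) = (Φ u)⁻¹ * Φ (u * v)) :
    (vᵀ * q * v).map (frobW p) = (vᵀ * q * v).map (· ^ p) := by
  have hφq : q.map (frobW p) = q := by
    ext1 i j
    exact frobW_eq_self_of_pow_eq_self (congrFun (congrFun hqp i) j)
  have hΦuq : (Φ u)ᵀ * q * Φ u = q := by rw [hΦ u hu, huq, hqp]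
  have hΦuv : Φ (u * v) = Φ u * v.map (frobW p) := by
    rw [heq, Matrix.mul_nonsing_inv_cancel_left _ _ ((Matrix.isUnit_iff_isUnit_det _).1 hΦu)]
  have huvq : (u * v)ᵀ * q * (u * v) = vᵀ * q * v := by
    conv_rhs => rw [← huq]
    simp only [Matrix.transpose_mul, Matrix.mul_assoc]
  calc (vᵀ * q * v).map (frobW p)
      = (v.map (frobW p))ᵀ * q * v.map (frobW p) := by
        rw [Matrix.map_mul, Matrix.map_mul, hφq, Matrix.transpose_map]
    _ = (Φ (u * v))ᵀ * q * Φ (u * v) := by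
        conv_lhs => rw [← hΦuq]
        simp only [hΦuv, Matrix.transpose_mul, Matrix.mul_assoc]
    _ = (vᵀ * q * v).map (· ^ p) := by rw [hΦ _ (hu.mul hv), huvq]
end
end

section
/- Let n ≥ 1, let O be a δ-subring of R, let α be an n×n matrix with entries in O, and let u ∈ GL_n(R) satisfy φ(u) = (1+pα)·u^(p). Let O[u] be the subring of R generated by O and the entries of u (this subring is stable under δ). Let σ be a ring automorphism of O[u] fixing O pointwise and commuting with δ on O[u], and suppose c := u⁻¹·σ(u) is invertible with both c and c⁻¹ having all entries in O (σ applied entrywise to u). Then (u·c)^(p) = u^(p)·φ(c). -/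
noncomputable section

open Matrix

/-- `O[u]`, the subring of `R` generated by `O` and the entries of `u`. -/
def genBy {p : ℕ} [Fact p.Prime] {n : ℕ} (O : Subring (Rp p))
    (u : Matrix (Fin n) (Fin n) (Rp p)) : Subring (Rp p) :=
  Subring.closure ((O : Set (Rp p)) ∪ {x | ∃ i j, u i j = x})

lemma mem_genBy {p : ℕ} [Fact p.Prime] {n : ℕ} (O : Subring (Rp p))
    (u : Matrix (Fin n) (Fin n) (Rp p)) (i j : Fin n) : u i j ∈ genBy O u :=
  Subring.subset_closure (Or.inr ⟨i, j, rfl⟩)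

/-- A left factor of an invertible square matrix over a commutative ring is left cancellable. -/
lemma Matrix.mul_left_cancel_of_isUnit_mul {m A : Type*} [Fintype m] [DecidableEq m] [CommRing A]
    {a b x y : Matrix m m A} (h : IsUnit (a * b)) (hxy : a * x = a * y) : x = y := by
  rw [Matrix.isUnit_iff_isUnit_det, Matrix.det_mul] at h
  exact ((Matrix.isUnit_iff_isUnit_det a).2 (isUnit_of_mul_isUnit_left h)).mul_left_cancel hxy

/-- For a Frobenius lift `φ a = a ^ p + p * δ a` with `p` a nonzero element of a domain, the
equation `φ(u) = (1 + pα) u^(p)` amounts to `δu = α u^(p)`. -/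
lemma map_eq_one_add_smul_mul_iff {m A : Type*} [Fintype m] [DecidableEq m] [CommRing A]
    [IsDomain A] {p : ℕ} (hp : (p : A) ≠ 0) {φ δ : A → A} (hδ : ∀ a, φ a = a ^ p + p * δ a)
    (α u : Matrix m m A) :
    u.map φ = (1 + (p : A) • α) * u.map (· ^ p) ↔ u.map δ = α * u.map (· ^ p) := by
  have hφ : u.map φ = u.map (· ^ p) + (p : A) • u.map δ := by
    ext i j
    simp [hδ]
  rw [hφ, add_mul, one_mul, add_right_inj, smul_mul_assoc, (smul_right_injective _ hp).eq_iff]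

/-- if `σ` is a `δ`-automorphism of `O[u]` over `O` with
`c = u⁻¹·σ(u) ∈ GL_n(O)`, then `(uc)^(p) = u^(p)·φ(c)`. -/
theorem statement9 {p : ℕ} [Fact p.Prime] (hp2 : p ≠ 2)
    (δ : Rp p → Rp p) (hδ : ∀ a, frobW p a = a ^ p + p * δ a)
    (n : ℕ) (hn : 1 ≤ n)
    (O : Subring (Rp p)) (hOδ : ∀ x ∈ O, δ x ∈ O)
    (α : Matrix (Fin n) (Fin n) (Rp p)) (hαO : ∀ i j, α i j ∈ O)
    (u : Matrix (Fin n) (Fin n) (Rp p)) (hu : IsUnit u)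
    (heq : u.map (frobW p) = (1 + (p : Rp p) • α) * u.map (· ^ p))
    (σ : genBy O u ≃+* genBy O u)
    (hσO : ∀ x : genBy O u, (x : Rp p) ∈ O → (σ x : Rp p) = x)
    (hσδ : ∀ x y : genBy O u, (y : Rp p) = δ (x : Rp p) →
      (σ y : Rp p) = δ (σ x : Rp p))
    (c : Matrix (Fin n) (Fin n) (Rp p))
    (hσu : ∀ i j, (σ ⟨u i j, mem_genBy O u i j⟩ : Rp p) = (u * c) i j)
    (hcO : ∀ i j, c i j ∈ O)
    (hcinv : ∃ d : Matrix (Fin n) (Fin n) (Rp p),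
      c * d = 1 ∧ d * c = 1 ∧ ∀ i j, d i j ∈ O) :
    (u * c).map (· ^ p) = u.map (· ^ p) * c.map (frobW p) := by
  have hp : (p : Rp p) ≠ 0 := WittVector.p_nonzero p _
  have hδu := (map_eq_one_add_smul_mul_iff hp hδ α u).1 heq
  have hO : ∀ x ∈ O, x ∈ genBy O u := fun x hx => Subring.subset_closure (Or.inl hx)
  have hδuc : (u * c).map δ = α * (u * c).map (· ^ p) := by
    ext i j : 1
    let y : genBy O u :=
      ∑ k, ⟨α i k, hO _ (hαO i k)⟩ * ⟨u k j, mem_genBy O u k j⟩ ^ p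
    have hy : (y : Rp p) = δ (u i j) := by
      simpa [y, Matrix.mul_apply] using (congrFun (congrFun hδu i) j).symm
    have hσy := hσδ ⟨u i j, mem_genBy O u i j⟩ y hy
    rw [hσu] at hσy
    rw [Matrix.map_apply, ← hσy, Matrix.mul_apply]
    simp only [y, map_sum, map_mul, map_pow, AddSubmonoidClass.coe_finsetSum,
      MulMemClass.coe_mul, SubmonoidClass.coe_pow, hσu, Matrix.map_apply]
    exact Finset.sum_congr rfl fun k _ => by rw [hσO _ (hαO i k)]
  have huc := (map_eq_one_add_smul_mul_iff hp hδ α (u * c)).2 hδuc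
  have hunit : IsUnit ((1 + (p : Rp p) • α) * u.map (· ^ p)) :=
    heq ▸ hu.map (frobW p).mapMatrix
  refine Matrix.mul_left_cancel_of_isUnit_mul hunit ?_
  rw [← huc, Matrix.map_mul, heq, Matrix.mul_assoc]
end
end

section
/- Let n ≥ 1 with p ∤ n and let λ : GL_n(R) → R be the function with λ(a) ≡ 1 mod p and λ(a)^n·det(a^(p)) = det(a)^p for all a ∈ GL_n(R). Let O be a δ-subring of R, let α be an n×n matrix with entries in O, and let u ∈ GL_n(R) satisfy φ(u) = (1+pα)·λ(u)·u^(p). Let O{u} be the subring of R generated by O and the entries of δ^i u for all i ≥ 0, and let σ be a ring automorphism of O{u} fixing O pointwise and commuting with δ on O{u}, such that c := u⁻¹·σ(u) is invertible with both c and c⁻¹ having all entries in O. Then φ(det c) = (det c)^p, i.e., δ(det c) = 0. -/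
noncomputable section

open Matrix

/-- `O{u}`, the subring of `R` generated by `O` and the entries of `δ^i u`, `i ≥ 0`. -/
def genByDelta {p : ℕ} [Fact p.Prime] (δ : Rp p → Rp p) {n : ℕ} (O : Subring (Rp p))
    (u : Matrix (Fin n) (Fin n) (Rp p)) : Subring (Rp p) :=
  Subring.closure ((O : Set (Rp p)) ∪ {x | ∃ (i : ℕ) (k l : Fin n), δ^[i] (u k l) = x})

lemma mem_genByDelta {p : ℕ} [Fact p.Prime] (δ : Rp p → Rp p) {n : ℕ}
    (O : Subring (Rp p)) (u : Matrix (Fin n) (Fin n) (Rp p)) (k l : Fin n) :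
    u k l ∈ genByDelta δ O u :=
  Subring.subset_closure (Or.inr ⟨0, k, l, rfl⟩)

/-- Let `ι, τ : S → R` be ring homomorphisms with `ι` injective, and let `U`, `F`, `B` be matrices
over `S` whose images are `u`, `φ(u)`, `b` under `ι` and `u * c`, `φ(u * c)`, `b` under `τ`. If
`φ(det u) = det b * (det u) ^ m` with `det u` a unit, then `φ(det c) = (det c) ^ m`. -/
lemma map_det_eq_pow_of_twist {S R ι' : Type*} [CommRing S] [CommRing R] [Fintype ι']
    [DecidableEq ι'] {ι τ : S →+* R} (hι : Function.Injective ι) (φ : R →+* R) (m : ℕ)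
    {U F B : Matrix ι' ι' S} {u c b : Matrix ι' ι' R} (hu : IsUnit u)
    (hU : ι.mapMatrix U = u) (hF : ι.mapMatrix F = φ.mapMatrix u) (hB : ι.mapMatrix B = b)
    (hτU : τ.mapMatrix U = u * c) (hτF : τ.mapMatrix F = φ.mapMatrix (u * c))
    (hτB : τ.mapMatrix B = b) (hdet : φ u.det = b.det * u.det ^ m) :
    φ c.det = c.det ^ m := by
  have hdetS : F.det = B.det * U.det ^ m := by
    apply hι
    rw [map_mul, map_pow, RingHom.map_det, RingHom.map_det, RingHom.map_det, hF, hB, hU,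
      ← RingHom.map_det, hdet]
  have hdetτ := congrArg τ hdetS
  rw [map_mul, map_pow, RingHom.map_det, RingHom.map_det, RingHom.map_det, hτF, hτB, hτU,
    ← RingHom.map_det, det_mul, map_mul, mul_pow, ← mul_assoc, ← hdet] at hdetτ
  exact (((isUnit_iff_isUnit_det u).mp hu).map φ).mul_left_cancel hdetτ

/-- A ring homomorphism applied to `1 + m • A` only depends on its values on the entries of `A`. -/
lemma mapMatrix_one_add_natCast_smul {S R ι' : Type*} [CommRing S] [CommRing R] [Fintype ι']
    [DecidableEq ι'] (f : S →+* R) (m : ℕ) (A : Matrix ι' ι' S) {α : Matrix ι' ι' R}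
    (hA : ∀ k l, f (A k l) = α k l) :
    f.mapMatrix (1 + (m : S) • A) = 1 + (m : R) • α := by
  rw [map_add, map_one]
  congr 1
  ext1 k l
  simp [hA]

/-- If `f` sends the entries of `U`, `D` to those of `v`, `δ v`, it sends `U ^ (p) + p D` to
`φ(v)`. -/
lemma mapMatrix_frobenius_lift {S R ι' : Type*} [CommRing S] [CommRing R] [Fintype ι']
    [DecidableEq ι'] (f : S →+* R) {φ : R →+* R} {δ : R → R} {p : ℕ}
    (hδ : ∀ a, φ a = a ^ p + p * δ a) (U D : Matrix ι' ι' S) {v : Matrix ι' ι' R}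
    (hU : ∀ k l, f (U k l) = v k l) (hD : ∀ k l, f (D k l) = δ (v k l)) :
    f.mapMatrix (of fun k l => U k l ^ p + (p : S) * D k l) = φ.mapMatrix v := by
  ext1 k l
  simp [hU, hD, hδ]

/-- for `Δ` of type `SL_n`, every element `c` of the `δ`-Galois group
`G_{u/O}` satisfies `δ(det c) = 0`, i.e. `φ(det c) = (det c)^p`. -/
theorem statement10 {p : ℕ} [Fact p.Prime] (hp2 : p ≠ 2)
    (δ : Rp p → Rp p) (hδ : ∀ a, frobW p a = a ^ p + p * δ a)
    (n : ℕ) (hn : 1 ≤ n) (hpn : ¬ (p ∣ n))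
    (lam : Matrix (Fin n) (Fin n) (Rp p) → Rp p)
    (hlam : ∀ a : Matrix (Fin n) (Fin n) (Rp p), IsUnit a →
      (p : Rp p) ∣ (lam a - 1) ∧ lam a ^ n * (a.map (· ^ p)).det = a.det ^ p)
    (O : Subring (Rp p)) (hOδ : ∀ x ∈ O, δ x ∈ O)
    (α : Matrix (Fin n) (Fin n) (Rp p)) (hαO : ∀ i j, α i j ∈ O)
    (u : Matrix (Fin n) (Fin n) (Rp p)) (hu : IsUnit u)
    (heq : u.map (frobW p) = lam u • ((1 + (p : Rp p) • α) * u.map (· ^ p)))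
    (σ : genByDelta δ O u ≃+* genByDelta δ O u)
    (hσO : ∀ x : genByDelta δ O u, (x : Rp p) ∈ O → (σ x : Rp p) = x)
    (hσδ : ∀ x y : genByDelta δ O u, (y : Rp p) = δ (x : Rp p) →
      (σ y : Rp p) = δ (σ x : Rp p))
    (c : Matrix (Fin n) (Fin n) (Rp p))
    (hσu : ∀ k l, (σ ⟨u k l, mem_genByDelta δ O u k l⟩ : Rp p) = (u * c) k l)
    (hcO : ∀ i j, c i j ∈ O)
    (hcinv : ∃ d : Matrix (Fin n) (Fin n) (Rp p),
      c * d = 1 ∧ d * c = 1 ∧ ∀ i j, d i j ∈ O) :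
    frobW p c.det = c.det ^ p := by
  have hOS : ∀ x ∈ O, x ∈ genByDelta δ O u := fun x hx => Subring.subset_closure (Or.inl hx)
  have hδS : ∀ k l, δ (u k l) ∈ genByDelta δ O u :=
    fun k l => Subring.subset_closure (Or.inr ⟨1, k, l, rfl⟩)
  let U : Matrix (Fin n) (Fin n) (genByDelta δ O u) :=
    of fun k l => ⟨u k l, mem_genByDelta δ O u k l⟩
  let D : Matrix (Fin n) (Fin n) (genByDelta δ O u) := of fun k l => ⟨δ (u k l), hδS k l⟩
  let A : Matrix (Fin n) (Fin n) (genByDelta δ O u) := of fun k l => ⟨α k l, hOS _ (hαO k l)⟩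
  let τ : genByDelta δ O u →+* Rp p := (genByDelta δ O u).subtype.comp σ.toRingHom
  have hτU : ∀ k l, τ (U k l) = (u * c) k l := hσu
  have hτD : ∀ k l, τ (D k l) = δ ((u * c) k l) := fun k l => by
    rw [← hσu k l]
    exact hσδ ⟨u k l, mem_genByDelta δ O u k l⟩ (D k l) rfl
  have hτA : ∀ k l, τ (A k l) = α k l := fun k l => hσO (A k l) (hαO k l)
  have hdet : frobW p u.det = (1 + (p : Rp p) • α).det * u.det ^ p := by
    rw [RingHom.map_det, RingHom.mapMatrix_apply, heq, det_smul, det_mul, ← (hlam u hu).2,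
      Fintype.card_fin]
    ring
  exact map_det_eq_pow_of_twist (genByDelta δ O u).subtype_injective (frobW p) p hu
    (U := U) (by ext1 k l; rfl)
    (mapMatrix_frobenius_lift _ hδ U D (fun _ _ => rfl) (fun _ _ => rfl))
    (mapMatrix_one_add_natCast_smul _ p A (fun _ _ => rfl))
    (by ext1 k l; exact hτU k l)
    (mapMatrix_frobenius_lift τ hδ U D hτU hτD)
    (mapMatrix_one_add_natCast_smul τ p A hτA) hdet
end
end

section
/- Let n ≥ 1, let O be a δ-subring of R, let u ∈ GL_n(R), and let c ∈ GL_n(R) with all entries of c in O. Suppose (u·c)^(p) = u^(p)·φ(c), and suppose there exists a row index m such that the entries u_{m1}, …, u_{mn} of the m-th row of u are algebraically independent over O. Then c ∈ N^δ: there is a permutation τ of {1,…,n} such that c_{ij} = 0 whenever i ≠ τ(j), and φ(c_{τ(j)j}) = (c_{τ(j)j})^p for every j. -/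
noncomputable section

open Matrix

/-- In characteristic zero, a linear form whose `p`-th power is a diagonal form of degree `p`
has `i`-th diagonal coefficient the `p`-th power of its own, and at most one nonzero
coefficient. -/
theorem MvPolynomial.linear_pow_eq_diagonal {σ A : Type*} [Fintype σ] [DecidableEq σ]
    [CommRing A] [IsDomain A] {p : ℕ} (hp : 2 ≤ p) (hpA : (p : A) ≠ 0) (a b : σ → A)
    (h : (∑ i, X i * C (a i) : MvPolynomial σ A) ^ p = ∑ i, X i ^ p * C (b i)) :
    (∀ i, b i = a i ^ p) ∧ ∀ i k, i ≠ k → a i = 0 ∨ a k = 0 := by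
  have hp0 : p ≠ 0 := by omega
  have hp1 : p - 1 ≠ 0 := by omega
  refine ⟨fun i => ?_, fun i k hik => ?_⟩
  · have := congrArg (eval (Pi.single i 1)) h
    simpa [Pi.single_apply, hp0, ite_pow] using this.symm
  · have := congrArg (fun f => eval (Pi.single k 1) (pderiv i f)) h
    simp [Pi.single_apply, hp1, hpA, hik, Derivation.leibniz_pow,
      pderiv_X] at this
    tauto

/-- if `(uc)^(p) = u^(p)·φ(c)`, `c` has entries in the `δ`-subring `O`,
and some row of `u` has entries algebraically independent over `O`, then `c` is a
monomial matrix whose nonzero entries `a` satisfy `φ(a) = a^p`. -/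
theorem statement12 {p : ℕ} [Fact p.Prime] (hp2 : p ≠ 2)
    (δ : Rp p → Rp p) (hδ : ∀ a, frobW p a = a ^ p + p * δ a)
    (n : ℕ) (hn : 1 ≤ n)
    (O : Subring (Rp p)) (hOδ : ∀ x ∈ O, δ x ∈ O)
    (u : Matrix (Fin n) (Fin n) (Rp p)) (hu : IsUnit u)
    (c : Matrix (Fin n) (Fin n) (Rp p)) (hc : IsUnit c)
    (hcO : ∀ i j, c i j ∈ O)
    (heq : (u * c).map (· ^ p) = u.map (· ^ p) * c.map (frobW p))
    (hind : ∃ m : Fin n, ∀ f : MvPolynomial (Fin n) (↥O),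
      MvPolynomial.eval₂ O.subtype (fun j => u m j) f = 0 → f = 0) :
    ∃ τ : Equiv.Perm (Fin n),
      (∀ i j, i ≠ τ j → c i j = 0) ∧
      (∀ j, frobW p (c (τ j) j) = (c (τ j) j) ^ p) := by
  have hp : p.Prime := Fact.out
  have hφO : ∀ x ∈ O, frobW p x ∈ O := fun x hx => by
    rw [hδ]
    exact O.add_mem (O.pow_mem hx p) (O.mul_mem (natCast_mem O p) (hOδ x hx))
  have hpR : (p : Rp p) ≠ 0 := WittVector.p_nonzero p _
  have hpO : (p : O) ≠ 0 := fun h => hpR (by simpa using congrArg O.subtype h)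
  obtain ⟨m, hm⟩ := hind
  have hcol (j : Fin n) := by
    refine MvPolynomial.linear_pow_eq_diagonal hp.two_le hpO
      (fun i => (⟨c i j, hcO i j⟩ : O)) (fun i => ⟨frobW p (c i j), hφO _ (hcO i j)⟩)
      (sub_eq_zero.mp (hm _ ?_))
    have := congrFun (congrFun heq m) j
    simp only [Matrix.map_apply, Matrix.mul_apply] at this
    simp [MvPolynomial.eval₂_sub, MvPolynomial.eval₂_pow, MvPolynomial.eval₂_sum,
      MvPolynomial.eval₂_mul, this]
  have hfrob (i j) : frobW p (c i j) = c i j ^ p := congrArg O.subtype ((hcol j).1 i)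
  have hzero (i k j) (hik : i ≠ k) : c i j = 0 ∨ c k j = 0 :=
    ((hcol j).2 i k hik).imp (congrArg O.subtype) (congrArg O.subtype)
  have hdet : c.det ≠ 0 := ((Matrix.isUnit_iff_isUnit_det c).mp hc).ne_zero
  have hcol_ne (j) : ∃ i, c i j ≠ 0 := by
    by_contra! h
    exact hdet (Matrix.det_eq_zero_of_column_eq_zero j h)
  have hrow_ne (i) : ∃ j, c i j ≠ 0 := by
    by_contra! h
    exact hdet (Matrix.det_eq_zero_of_row_eq_zero i h)
  choose τ hτ using hcol_ne
  have huniq (i j) (hij : i ≠ τ j) : c i j = 0 := (hzero i (τ j) j hij).resolve_right (hτ j)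
  have hsurj : Function.Surjective τ := fun i => by
    obtain ⟨j, hj⟩ := hrow_ne i
    exact ⟨j, by_contra fun h => hj (huniq i j (Ne.symm h))⟩
  exact ⟨Equiv.ofBijective τ (Finite.surjective_iff_bijective.mp hsurj), huniq,
    fun j => hfrob _ _⟩
end
end

section
/- Let n ≥ 1, let O be a δ-subring of R, let α be an n×n matrix with entries in O, and let u ∈ GL_n(R) satisfy φ(u) = (1+pα)·u^(p). Assume the n² entries of u are algebraically independent over O. Then G_{u/O} = N^δ ∩ GL_n(O): a matrix c ∈ GL_n(R) belongs to the δ-Galois group G_{u/O} if and only if c is a monomial matrix all of whose nonzero entries are elements of R^δ lying in O. -/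
noncomputable section

open Matrix

/-- The `δ`-Galois group `G_{u/O}`: the set of matrices `c` such that `c` and `c⁻¹`
have entries in `O` and `σ(u) = u·c` for some `δ`-automorphism `σ` of `O[u]` over `O`. -/
def galoisGroup {p : ℕ} [Fact p.Prime] (δ : Rp p → Rp p) {n : ℕ} (O : Subring (Rp p))
    (u : Matrix (Fin n) (Fin n) (Rp p)) : Set (Matrix (Fin n) (Fin n) (Rp p)) :=
  {c | (∀ i j, c i j ∈ O) ∧
    (∃ d : Matrix (Fin n) (Fin n) (Rp p),
      c * d = 1 ∧ d * c = 1 ∧ ∀ i j, d i j ∈ O) ∧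
    ∃ σ : genBy O u ≃+* genBy O u,
      (∀ x : genBy O u, (x : Rp p) ∈ O → (σ x : Rp p) = x) ∧
      (∀ x y : genBy O u, (y : Rp p) = δ (x : Rp p) →
        (σ y : Rp p) = δ (σ x : Rp p)) ∧
      (∀ i j, (σ ⟨u i j, mem_genBy O u i j⟩ : Rp p) = (u * c) i j)}

/-- If a linear form `∑ wₘ cₘ` satisfies `(∑ wₘ cₘ) ^ q = ∑ wₘ ^ q bₘ` identically, then
`b` consists of the `q`-th powers of the entries of `c`. -/
lemma eq_pow_of_linear_pow_eq {A : Type*} [CommRing A] {n q : ℕ}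
    (hq : 2 ≤ q) (c b : Fin n → A)
    (h : ∀ w : Fin n → Polynomial A,
      (∑ m, w m * Polynomial.C (c m)) ^ q = ∑ m, w m ^ q * Polynomial.C (b m)) (k : Fin n) :
    b k = c k ^ q := by
  have h1 := h (Pi.single k 1)
  rw [Finset.sum_eq_single k, Finset.sum_eq_single k] at h1
  · simp only [Pi.single_eq_same, one_mul, one_pow, ← Polynomial.C_pow] at h1
    exact (Polynomial.C_injective h1).symm
  · intro m _ hm
    simp [hm, show q ≠ 0 by omega]
  · simp
  · intro m _ hm
    simp [hm]
  · simp

/-- If a linear form `∑ wₘ cₘ` satisfies `(∑ wₘ cₘ) ^ q = ∑ wₘ ^ q bₘ` identically, and `q ≠ 0`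
in the domain `A`, then at most one `cₘ` is nonzero. -/
lemma eq_zero_or_eq_zero_of_linear_pow_eq {A : Type*} [CommRing A] [IsDomain A] {n q : ℕ}
    (hq : 2 ≤ q) (hqA : (q : A) ≠ 0) (c b : Fin n → A)
    (h : ∀ w : Fin n → Polynomial A,
      (∑ m, w m * Polynomial.C (c m)) ^ q = ∑ m, w m ^ q * Polynomial.C (b m))
    {k l : Fin n} (hkl : k ≠ l) : c k = 0 ∨ c l = 0 := by
  have h1 := h (fun m => if m = k then 1 else if m = l then Polynomial.X else 0)
  rw [Finset.sum_eq_add k l hkl, Finset.sum_eq_add k l hkl] at h1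
  · simp only [if_true, if_neg hkl.symm, one_mul, one_pow] at h1
    have h2 := congrArg (fun P => (Polynomial.derivative P).eval 0) h1
    simp [Polynomial.derivative_pow, show q - 1 ≠ 0 by omega] at h2
    rcases h2 with (h2 | h2) | h2
    · exact absurd h2 hqA
    · exact Or.inl h2
    · exact Or.inr h2
  · intro m _ hm
    simp [hm.1, hm.2, show q ≠ 0 by omega]
  · simp
  · simp
  · intro m _ hm
    simp [hm.1, hm.2]
  · simp
  · simp

/-- An invertible matrix with at most one nonzero entry in each column is monomial. -/
lemma exists_perm_of_column_subsingleton {A : Type*} [CommRing A] [Nontrivial A] {n : ℕ}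
    (c d : Matrix (Fin n) (Fin n) A) (hcd : c * d = 1) (hdc : d * c = 1)
    (h : ∀ j k l, k ≠ l → c k j = 0 ∨ c l j = 0) :
    ∃ τ : Equiv.Perm (Fin n), (∀ i j, i ≠ τ j → c i j = 0) ∧ ∀ j, c (τ j) j ≠ 0 := by
  have hcol : ∀ j, ∃ i, c i j ≠ 0 := by
    intro j
    by_contra! hz
    have := congrFun (congrFun hdc j) j
    simp [Matrix.mul_apply, hz] at this
  choose t ht using hcol
  have hz : ∀ i j, i ≠ t j → c i j = 0 := fun i j hij =>
    (h j i (t j) hij).resolve_right (ht j)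
  have hsurj : Function.Surjective t := by
    intro i
    by_contra! hi
    have := congrFun (congrFun hcd i) i
    simp [Matrix.mul_apply, fun j => hz i j (hi j).symm] at this
  exact ⟨Equiv.ofBijective t (Finite.injective_iff_bijective.mp
    (Finite.injective_iff_surjective.mpr hsurj)), hz, ht⟩

lemma Matrix.mul_left_cancel_of_det_ne_zero {A : Type*} [CommRing A] [IsDomain A] {n : ℕ}
    {M x y : Matrix (Fin n) (Fin n) A} (hM : M.det ≠ 0) (h : M * x = M * y) : x = y := by
  have h1 := congrArg (fun z => M.adjugate * z) h
  simp only [← Matrix.mul_assoc, Matrix.adjugate_mul, Matrix.smul_mul, Matrix.one_mul] at h1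
  ext i j
  have h2 := congrFun (congrFun h1 i) j
  simpa [hM] using h2

section DeltaGalois

variable {p : ℕ} [Fact p.Prime]

lemma natCast_p_ne_zero : (p : Rp p) ≠ 0 :=
  WittVector.p_nonzero p (AlgebraicClosure (ZMod p))

lemma det_one_add_p_smul_ne_zero {n : ℕ} (α : Matrix (Fin n) (Fin n) (Rp p)) :
    (1 + (p : Rp p) • α).det ≠ 0 := by
  intro h
  have h1 := congrArg (WittVector.constantCoeff (p := p) (R := AlgebraicClosure (ZMod p))) h
  rw [RingHom.map_det, map_zero] at h1
  have h2 : (WittVector.constantCoeff (p := p) (R := AlgebraicClosure (ZMod p))).mapMatrix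
      (1 + (p : Rp p) • α) = 1 := by
    ext i j
    rw [RingHom.mapMatrix_apply, Matrix.map_apply, Matrix.add_apply, Matrix.smul_apply, smul_eq_mul,
      map_add, map_mul, map_natCast, CharP.cast_eq_zero, zero_mul, add_zero]
    by_cases hij : i = j <;> simp [hij, Matrix.one_apply]
  rw [h2, Matrix.det_one] at h1
  exact one_ne_zero h1

lemma frobW_mem {δ : Rp p → Rp p} (hδ : ∀ a, frobW p a = a ^ p + p * δ a)
    {O : Subring (Rp p)} (hOδ : ∀ x ∈ O, δ x ∈ O) {x : Rp p} (hx : x ∈ O) : frobW p x ∈ O := by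
  rw [hδ]
  exact O.add_mem (O.pow_mem hx p) (O.mul_mem (natCast_mem O p) (hOδ x hx))

/-- Evaluation of polynomials over `O` at the entries of `u`. -/
def evalEntries {n : ℕ} (O : Subring (Rp p)) (u : Matrix (Fin n) (Fin n) (Rp p)) :
    MvPolynomial (Fin n × Fin n) O →+* Rp p :=
  MvPolynomial.eval₂Hom O.subtype (fun kl => u kl.1 kl.2)

@[simp]
lemma evalEntries_C {n : ℕ} (O : Subring (Rp p)) (u : Matrix (Fin n) (Fin n) (Rp p)) (a : O) :
    evalEntries O u (MvPolynomial.C a) = a := by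
  simp [evalEntries]

@[simp]
lemma evalEntries_X {n : ℕ} (O : Subring (Rp p)) (u : Matrix (Fin n) (Fin n) (Rp p))
    (kl : Fin n × Fin n) : evalEntries O u (MvPolynomial.X kl) = u kl.1 kl.2 := by
  simp [evalEntries]

lemma range_evalEntries {n : ℕ} (O : Subring (Rp p)) (u : Matrix (Fin n) (Fin n) (Rp p)) :
    (evalEntries O u).range = genBy O u := by
  apply le_antisymm
  · rintro _ ⟨f, rfl⟩
    induction f using MvPolynomial.induction_on with
    | C a =>
      rw [evalEntries_C]
      exact Subring.subset_closure (Or.inl a.2)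
    | add f g hf hg => simpa using (genBy O u).add_mem hf hg
    | mul_X f kl hf =>
      rw [map_mul, evalEntries_X]
      exact (genBy O u).mul_mem hf (mem_genBy O u _ _)
  · refine Subring.closure_le.mpr ?_
    rintro x (hx | ⟨i, j, rfl⟩)
    · exact ⟨MvPolynomial.C ⟨x, hx⟩, by simp⟩
    · exact ⟨MvPolynomial.X (i, j), by simp⟩

/-- The substitution `x ↦ x·c` on polynomials in the entries of a matrix `x`. -/
def substMul {B : Type*} [CommRing B] {n : ℕ} (c : Matrix (Fin n) (Fin n) B) :
    MvPolynomial (Fin n × Fin n) B →ₐ[B] MvPolynomial (Fin n × Fin n) B :=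
  MvPolynomial.aeval fun kl => ∑ m, MvPolynomial.X (kl.1, m) * MvPolynomial.C (c m kl.2)

lemma substMul_comp_of_mul_eq_one {B : Type*} [CommRing B] {n : ℕ}
    {c d : Matrix (Fin n) (Fin n) B} (h : d * c = 1) :
    (substMul d).comp (substMul c) = AlgHom.id B _ := by
  apply MvPolynomial.algHom_ext
  rintro ⟨i, j⟩
  have hC : ∀ (e : Matrix (Fin n) (Fin n) B) (b : B),
      substMul e (MvPolynomial.C b) = MvPolynomial.C b := fun e b => by
    simp [substMul]
  have hX : ∀ (e : Matrix (Fin n) (Fin n) B) (k l : Fin n),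
      substMul e (MvPolynomial.X (k, l)) =
        ∑ m, MvPolynomial.X (k, m) * MvPolynomial.C (e m l) := fun e k l => by
    simp [substMul]
  simp only [AlgHom.comp_apply, AlgHom.id_apply, hX, map_sum, map_mul, hC, Finset.sum_mul]
  rw [Finset.sum_comm]
  have h1 : ∀ m, ∑ x, MvPolynomial.X (R := B) (i, m) * MvPolynomial.C (d m x) *
      MvPolynomial.C (c x j) = MvPolynomial.X (i, m) * MvPolynomial.C ((1 : Matrix _ _ B) m j) := by
    intro m
    simp [← h, Matrix.mul_apply, Finset.mul_sum, mul_assoc]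
  simp only [h1]
  rw [Finset.sum_eq_single j]
  · simp
  · intro m _ hm
    simp [hm]
  · simp

/-- The automorphism `x ↦ x·c` of polynomials in the entries of a matrix `x`, for `c`
invertible. -/
def substMulEquiv {B : Type*} [CommRing B] {n : ℕ} (c d : Matrix (Fin n) (Fin n) B)
    (hcd : c * d = 1) (hdc : d * c = 1) :
    MvPolynomial (Fin n × Fin n) B ≃ₐ[B] MvPolynomial (Fin n × Fin n) B :=
  AlgEquiv.ofAlgHom (substMul c) (substMul d)
    (substMul_comp_of_mul_eq_one hcd) (substMul_comp_of_mul_eq_one hdc)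

variable {δ : Rp p → Rp p} {n : ℕ} {O : Subring (Rp p)}
  {α u c : Matrix (Fin n) (Fin n) (Rp p)}

/-- The `δ`-form of the equation `φ(u) = (1 + pα)·u^(p)`. -/
lemma delta_eq_of_frob_eq (hδ : ∀ a, frobW p a = a ^ p + p * δ a)
    (heq : u.map (frobW p) = (1 + (p : Rp p) • α) * u.map (· ^ p)) (i j : Fin n) :
    δ (u i j) = ∑ k, α i k * u k j ^ p := by
  have h := congrFun (congrFun heq i) j
  rw [Matrix.add_mul, Matrix.one_mul, Matrix.smul_mul, Matrix.map_apply, hδ] at h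
  simp only [Matrix.add_apply, Matrix.map_apply, Matrix.smul_apply, smul_eq_mul,
    Matrix.mul_apply, add_right_inj] at h
  exact mul_left_cancel₀ natCast_p_ne_zero h

/-- A matrix in the `δ`-Galois group satisfies `(uc)^(p) = u^(p)·φ(c)`. -/
lemma map_pow_mul_of_mem_galoisGroup (hδ : ∀ a, frobW p a = a ^ p + p * δ a)
    (hαO : ∀ i j, α i j ∈ O)
    (heq : u.map (frobW p) = (1 + (p : Rp p) • α) * u.map (· ^ p))
    (hc : c ∈ galoisGroup δ O u) :
    (u * c).map (· ^ p) = u.map (· ^ p) * c.map (frobW p) := by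
  obtain ⟨-, -, σ, hσO, hσδ, hσu⟩ := hc
  have hO : ∀ {x}, x ∈ O → x ∈ genBy O u := fun hx => Subring.subset_closure (Or.inl hx)
  have hδuc : ∀ i j, δ ((u * c) i j) = ∑ k, α i k * (u * c) k j ^ p := by
    intro i j
    let y : genBy O u := ∑ k, ⟨α i k, hO (hαO i k)⟩ * ⟨u k j, mem_genBy O u k j⟩ ^ p
    have hy : (y : Rp p) = δ (u i j) := by
      simp [y, delta_eq_of_frob_eq hδ heq]
    have h := hσδ ⟨u i j, mem_genBy O u i j⟩ y hy
    rw [hσu] at h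
    rw [← h]
    have hσα : ∀ k, (σ ⟨α i k, hO (hαO i k)⟩ : Rp p) = α i k := fun k => hσO _ (hαO i k)
    simp only [y, map_sum, map_mul, map_pow, AddSubmonoidClass.coe_finsetSum, Subring.coe_mul,
      Subring.coe_pow, hσu, hσα]
  apply Matrix.mul_left_cancel_of_det_ne_zero (det_one_add_p_smul_ne_zero α)
  rw [← Matrix.mul_assoc, ← heq, ← Matrix.map_mul]
  ext i j : 1
  rw [Matrix.add_mul, Matrix.one_mul, Matrix.smul_mul, Matrix.map_apply (f := frobW p), hδ, hδuc]
  simp only [Matrix.add_apply, Matrix.map_apply, Matrix.smul_apply, smul_eq_mul,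
    Matrix.mul_apply (M := α)]

/-- If `(uc)^(p) = u^(p)·φ(c)` with `u` generic over `O`, the identity holds for every row vector
of polynomials in place of a row of `u`. -/
lemma linear_pow_eq_of_map_pow_mul (hc : ∀ i j, c i j ∈ O) (hφc : ∀ i j, frobW p (c i j) ∈ O)
    (hind : Function.Injective (evalEntries O u))
    (h : (u * c).map (· ^ p) = u.map (· ^ p) * c.map (frobW p)) (i j : Fin n)
    (w : Fin n → Polynomial (Rp p)) :
    (∑ m, w m * Polynomial.C (c m j)) ^ p =
      ∑ m, w m ^ p * Polynomial.C (frobW p (c m j)) := by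
  have h1 : (∑ m, MvPolynomial.X (i, m) * MvPolynomial.C ⟨c m j, hc m j⟩ :
      MvPolynomial (Fin n × Fin n) O) ^ p =
      ∑ m, MvPolynomial.X (i, m) ^ p * MvPolynomial.C ⟨frobW p (c m j), hφc m j⟩ := by
    apply hind
    have h2 := congrFun (congrFun h i) j
    simpa [Matrix.mul_apply] using h2
  have h3 := congrArg (MvPolynomial.eval₂Hom (Polynomial.C.comp O.subtype)
    (fun kl : Fin n × Fin n => w kl.2)) h1
  simpa using h3

/-- A monomial matrix with entries killed by `δ` satisfies `(uc)^(p) = u^(p)·φ(c)`. -/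
lemma map_pow_mul_of_monomial (hδ : ∀ a, frobW p a = a ^ p + p * δ a) {τ : Equiv.Perm (Fin n)}
    (hz : ∀ i j, i ≠ τ j → c i j = 0) (hτ : ∀ j, δ (c (τ j) j) = 0) :
    (u * c).map (· ^ p) = u.map (· ^ p) * c.map (frobW p) := by
  ext i j : 1
  simp only [Matrix.map_apply, Matrix.mul_apply]
  rw [Finset.sum_eq_single (τ j), Finset.sum_eq_single (τ j)]
  · rw [hδ, hτ, mul_zero, add_zero, mul_pow]
  · intro m _ hm
    rw [hz m j hm, map_zero, mul_zero]
  · simp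
  · intro m _ hm
    rw [hz m j hm, mul_zero]
  · simp

lemma mem_galoisGroup_of_map_pow_mul (hδ : ∀ a, frobW p a = a ^ p + p * δ a)
    (hOδ : ∀ x ∈ O, δ x ∈ O) (hαO : ∀ i j, α i j ∈ O)
    (heq : u.map (frobW p) = (1 + (p : Rp p) • α) * u.map (· ^ p))
    (hind : Function.Injective (evalEntries O u))
    (hcO : ∀ i j, c i j ∈ O) {d : Matrix (Fin n) (Fin n) (Rp p)} (hcd : c * d = 1)
    (hdc : d * c = 1) (hdO : ∀ i j, d i j ∈ O)
    (h : (u * c).map (· ^ p) = u.map (· ^ p) * c.map (frobW p)) :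
    c ∈ galoisGroup δ O u := by
  refine ⟨hcO, ⟨d, hcd, hdc, hdO⟩, ?_⟩
  let cO : Matrix (Fin n) (Fin n) O := fun i j => ⟨c i j, hcO i j⟩
  let dO : Matrix (Fin n) (Fin n) O := fun i j => ⟨d i j, hdO i j⟩
  have hinj : Function.Injective (O.subtype.mapMatrix (m := Fin n)) :=
    Matrix.map_injective Subtype.val_injective
  have hcO_map : O.subtype.mapMatrix cO = c := rfl
  have hdO_map : O.subtype.mapMatrix dO = d := rfl
  have hcdO : cO * dO = 1 := hinj (by rw [map_mul, map_one, hcO_map, hdO_map, hcd])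
  have hdcO : dO * cO = 1 := hinj (by rw [map_mul, map_one, hcO_map, hdO_map, hdc])
  obtain ⟨S, hSX, hSC⟩ : ∃ S : MvPolynomial (Fin n × Fin n) O ≃+* MvPolynomial (Fin n × Fin n) O,
      (∀ i j, evalEntries O u (S (MvPolynomial.X (i, j))) = (u * c) i j) ∧
        ∀ a : O, S (MvPolynomial.C a) = MvPolynomial.C a :=
    ⟨(substMulEquiv cO dO hcdO hdcO).toRingEquiv, fun i j => by
      simp [substMulEquiv, substMul, Matrix.mul_apply, cO],
      (substMulEquiv cO dO hcdO hdcO).commutes⟩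
  obtain ⟨e, he⟩ : ∃ e : MvPolynomial (Fin n × Fin n) O ≃+* genBy O u,
      ∀ f, (e f : Rp p) = evalEntries O u f :=
    ⟨(RingEquiv.ofBijective (evalEntries O u).rangeRestrict
      ⟨fun f g hfg => hind (congrArg Subtype.val hfg),
        (evalEntries O u).rangeRestrict_surjective⟩).trans
      (RingEquiv.subringCongr (range_evalEntries O u)), fun f => rfl⟩
  let φO : O →+* O := ((frobW p).comp O.subtype).codRestrict O fun x => frobW_mem hδ hOδ x.2
  let Φ : MvPolynomial (Fin n × Fin n) O →+* MvPolynomial (Fin n × Fin n) O :=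
    MvPolynomial.eval₂Hom (MvPolynomial.C.comp φO) fun kl : Fin n × Fin n =>
      MvPolynomial.X kl ^ p + (p : MvPolynomial (Fin n × Fin n) O) * ∑ m, MvPolynomial.C ⟨α kl.1 m, hαO kl.1 m⟩ *
        MvPolynomial.X (m, kl.2) ^ p
  have hΦX : ∀ i j, Φ (MvPolynomial.X (i, j)) = MvPolynomial.X (i, j) ^ p +
      (p : MvPolynomial (Fin n × Fin n) O) *
        ∑ m, MvPolynomial.C ⟨α i m, hαO i m⟩ * MvPolynomial.X (m, j) ^ p := fun i j => by
    simp [Φ]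
  have hΦC : ∀ a, Φ (MvPolynomial.C a) = MvPolynomial.C (φO a) := fun a => by
    simp [Φ]
  have hφO : ∀ a, (φO a : Rp p) = frobW p a := fun a => rfl
  have hΦ : ∀ f, evalEntries O u (Φ f) = frobW p (evalEntries O u f) := by
    refine RingHom.congr_fun (f := (evalEntries O u).comp Φ)
      (g := (frobW p).comp (evalEntries O u)) (MvPolynomial.ringHom_ext (fun a => ?_) ?_)
    · simp only [RingHom.comp_apply, hΦC, evalEntries_C, hφO]
    · rintro ⟨i, j⟩
      simp only [RingHom.comp_apply, hΦX, evalEntries_X]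
      rw [hδ, delta_eq_of_frob_eq hδ heq]
      simp
  have hφuc : (u * c).map (frobW p) = (1 + (p : Rp p) • α) * (u * c).map (· ^ p) := by
    rw [h, Matrix.map_mul, heq, Matrix.mul_assoc]
  have hSΦ : ∀ f, evalEntries O u (S (Φ f)) = frobW p (evalEntries O u (S f)) := by
    have hcomp : ((evalEntries O u).comp S.toRingHom).comp Φ =
        (frobW p).comp ((evalEntries O u).comp S.toRingHom) := by
      apply MvPolynomial.ringHom_ext
      · intro a
        simp only [RingHom.comp_apply, RingEquiv.toRingHom_eq_coe, RingHom.coe_coe, hΦC, hSC,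
          evalEntries_C, hφO]
      · rintro ⟨i, j⟩
        simp only [RingHom.comp_apply, RingEquiv.toRingHom_eq_coe, RingHom.coe_coe, hΦX, hSX]
        rw [hδ, delta_eq_of_frob_eq hδ hφuc]
        simp [hSX, hSC]
    exact RingHom.congr_fun hcomp
  refine ⟨(e.symm.trans S).trans e, ?_, ?_, ?_⟩
  · intro x hx
    have hxe : x = e (MvPolynomial.C ⟨x, hx⟩) := Subtype.ext (by simp [he])
    change (e (S (e.symm x)) : Rp p) = x
    rw [hxe, e.symm_apply_apply, hSC]
  · intro x y hxy
    obtain ⟨f, rfl⟩ := e.surjective x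
    obtain ⟨g, rfl⟩ := e.surjective y
    change (e (S (e.symm (e g))) : Rp p) = δ (e (S (e.symm (e f))) : Rp p)
    rw [e.symm_apply_apply, e.symm_apply_apply, he, he]
    rw [he, he] at hxy
    have h1 : Φ f = f ^ p + p * g := hind (by
      rw [hΦ, hδ, ← hxy]
      simp)
    have h2 := hSΦ f
    rw [h1, hδ] at h2
    simp only [map_add, map_mul, map_pow, map_natCast, add_right_inj] at h2
    exact mul_left_cancel₀ natCast_p_ne_zero h2
  · intro i j
    have hxe : (⟨u i j, mem_genBy O u i j⟩ : genBy O u) = e (MvPolynomial.X (i, j)) :=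
      Subtype.ext (by simp [he])
    change (e (S (e.symm ⟨u i j, mem_genBy O u i j⟩)) : Rp p) = _
    rw [hxe, e.symm_apply_apply, he, hSX]

end DeltaGalois

/-- if the entries of `u` are algebraically independent over `O`, then
`G_{u/O} = N^δ ∩ GL_n(O)`. -/
theorem statement13 {p : ℕ} [Fact p.Prime] (hp2 : p ≠ 2)
    (δ : Rp p → Rp p) (hδ : ∀ a, frobW p a = a ^ p + p * δ a)
    (n : ℕ) (hn : 1 ≤ n)
    (O : Subring (Rp p)) (hOδ : ∀ x ∈ O, δ x ∈ O)
    (α : Matrix (Fin n) (Fin n) (Rp p)) (hαO : ∀ i j, α i j ∈ O)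
    (u : Matrix (Fin n) (Fin n) (Rp p)) (hu : IsUnit u)
    (heq : u.map (frobW p) = (1 + (p : Rp p) • α) * u.map (· ^ p))
    (hind : ∀ f : MvPolynomial (Fin n × Fin n) (↥O),
      MvPolynomial.eval₂ O.subtype (fun kl => u kl.1 kl.2) f = 0 → f = 0) :
    ∀ c : Matrix (Fin n) (Fin n) (Rp p),
      c ∈ galoisGroup δ O u ↔
        ((∃ τ : Equiv.Perm (Fin n),
            (∀ i j, i ≠ τ j → c i j = 0) ∧
            (∀ j, c (τ j) j ≠ 0 ∧ δ (c (τ j) j) = 0)) ∧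
          (∀ i j, c i j ∈ O) ∧
          ∃ d : Matrix (Fin n) (Fin n) (Rp p),
            c * d = 1 ∧ d * c = 1 ∧ ∀ i j, d i j ∈ O) := by
  intro c
  have hinj : Function.Injective (evalEntries O u) :=
    (injective_iff_map_eq_zero _).mpr hind
  have hp : p.Prime := Fact.out
  constructor
  · intro hc
    obtain ⟨hcO, ⟨d, hcd, hdc, hdO⟩, -⟩ := id hc
    have hw := linear_pow_eq_of_map_pow_mul hcO (fun i j => frobW_mem hδ hOδ (hcO i j)) hinj
      (map_pow_mul_of_mem_galoisGroup hδ hαO heq hc) ⟨0, hn⟩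
    obtain ⟨τ, hz, hτ⟩ := exists_perm_of_column_subsingleton c d hcd hdc fun j _ _ hkl =>
      eq_zero_or_eq_zero_of_linear_pow_eq hp.two_le natCast_p_ne_zero (fun m => c m j) _
        (hw j) hkl
    refine ⟨⟨τ, hz, fun j => ⟨hτ j, ?_⟩⟩, hcO, d, hcd, hdc, hdO⟩
    have h1 := eq_pow_of_linear_pow_eq hp.two_le (fun m => c m j) _ (hw j) (τ j)
    rw [hδ] at h1
    exact (mul_eq_zero.mp (add_eq_left.mp h1)).resolve_left natCast_p_ne_zero
  · rintro ⟨⟨τ, hz, hτ⟩, hcO, d, hcd, hdc, hdO⟩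
    exact mem_galoisGroup_of_map_pow_mul hδ hOδ hαO heq hinj hcO hcd hdc hdO
      (map_pow_mul_of_monomial hδ hz fun j => (hτ j).2)
end
end

section
/- Let n ≥ 1 and let v ∈ GL_n(R). Then (u·v)^(p) = u^(p)·φ(v) holds for all u ∈ GL_n(R) if and only if v ∈ N^δ, i.e., v is a monomial matrix all of whose nonzero entries a satisfy φ(a) = a^p. Equivalently, with G_u := {v ∈ GL_n(R) : (uv)^(p) = u^(p)·φ(v)} (the solution set attached to u for Δ = 0), one has ⋂_{u ∈ GL_n(R)} G_u = N^δ. -/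
noncomputable section

open Matrix

/-- In a domain of characteristic zero, the `p`-th power map is additive along the line
`t ↦ x + t * y` only if one of `x`, `y` vanishes. -/
theorem eq_zero_or_eq_zero_of_forall_add_pow {R : Type*} [CommRing R] [IsDomain R] [CharZero R]
    {p : ℕ} (hp : 1 < p) {x y : R} (h : ∀ t : R, (x + t * y) ^ p = x ^ p + t ^ p * y ^ p) :
    x = 0 ∨ y = 0 := by
  have hpoly : (Polynomial.C x + Polynomial.X * Polynomial.C y) ^ p =
      Polynomial.C (x ^ p) + Polynomial.X ^ p * Polynomial.C (y ^ p) := by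
    refine Polynomial.funext fun t => ?_
    simpa [mul_comm t y] using h t
  have hder := congrArg (fun q => (Polynomial.derivative q).eval 0) hpoly
  have hp0 : p ≠ 0 := by omega
  have hp1 : p - 1 ≠ 0 := by omega
  simp [Polynomial.derivative_pow, hp0, hp1] at hder
  tauto

/-- A Witt vector ring over a domain of characteristic `p` has characteristic zero. -/
theorem charZero_wittVector {p : ℕ} [Fact p.Prime] (k : Type*) [CommRing k] [IsDomain k]
    [CharP k p] : CharZero (WittVector p k) := by
  obtain ⟨q, hq⟩ := CharP.exists (WittVector p k)
  rcases CharP.char_is_prime_or_zero (WittVector p k) q with hprime | rfl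
  · have hqk : (q : k) = 0 := by
      rw [← map_natCast (WittVector.constantCoeff (p := p) (R := k)) q, CharP.cast_eq_zero,
        map_zero]
    have hpq : p = q :=
      (Nat.prime_dvd_prime_iff_eq Fact.out hprime).mp ((CharP.cast_eq_zero_iff k p q).mp hqk)
    subst hpq
    exact absurd (CharP.cast_eq_zero (WittVector p k) p) (WittVector.p_nonzero p k)
  · exact CharP.charP_to_charZero _

/-- An invertible matrix with at most one nonzero entry in each column is monomial. -/
theorem exists_perm_of_isUnit {ι R : Type*} [Fintype ι] [DecidableEq ι] [CommRing R]
    [Nontrivial R] {v : Matrix ι ι R} (hv : IsUnit v)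
    (h : ∀ a b j, a ≠ b → v a j = 0 ∨ v b j = 0) :
    ∃ τ : Equiv.Perm ι, (∀ i j, i ≠ τ j → v i j = 0) ∧ ∀ j, v (τ j) j ≠ 0 := by
  have hdet : v.det ≠ 0 := ((Matrix.isUnit_iff_isUnit_det v).mp hv).ne_zero
  have hcol : ∀ j, ∃ i, v i j ≠ 0 := by
    intro j
    by_contra! hj
    exact hdet (Matrix.det_eq_zero_of_column_eq_zero j hj)
  choose f hf using hcol
  have hzero : ∀ i j, i ≠ f j → v i j = 0 := fun i j hij =>
    (h i (f j) j hij).resolve_right (hf j)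
  have hsurj : Function.Surjective f := by
    intro i
    by_contra! hi
    exact hdet (Matrix.det_eq_zero_of_row_eq_zero i fun j => hzero i j (hi j).symm)
  exact ⟨Equiv.ofBijective f (Finite.surjective_iff_bijective.mp hsurj), hzero, hf⟩

/-- for `v ∈ GL_n(R)`, `(uv)^(p) = u^(p)·φ(v)` holds for all
`u ∈ GL_n(R)` if and only if `v` is a monomial matrix all of whose nonzero entries
`a` satisfy `φ(a) = a^p`; i.e. `⋂_{u} G_u = N^δ`. -/
theorem statement14 {p : ℕ} [Fact p.Prime] (hp2 : p ≠ 2)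
    (n : ℕ) (hn : 1 ≤ n)
    (v : Matrix (Fin n) (Fin n) (Rp p)) (hv : IsUnit v) :
    (∀ u : Matrix (Fin n) (Fin n) (Rp p), IsUnit u →
        (u * v).map (· ^ p) = u.map (· ^ p) * v.map (frobW p)) ↔
      ∃ τ : Equiv.Perm (Fin n),
        (∀ i j, i ≠ τ j → v i j = 0) ∧
        (∀ j, v (τ j) j ≠ 0 ∧ frobW p (v (τ j) j) = (v (τ j) j) ^ p) := by
  have : CharZero (Rp p) := charZero_wittVector _
  have hp : p.Prime := Fact.out
  constructor
  · intro H
    have hfrob : ∀ i j, frobW p (v i j) = v i j ^ p := by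
      intro i j
      have h := congrFun (congrFun (H 1 isUnit_one) i) j
      rw [Matrix.map_one (· ^ p) (zero_pow hp.ne_zero) (one_pow p), one_mul, one_mul] at h
      exact h.symm
    obtain ⟨τ, hτ, hne⟩ := exists_perm_of_isUnit hv fun a b j hab => by
      refine eq_zero_or_eq_zero_of_forall_add_pow hp.one_lt fun t => ?_
      have hu : IsUnit (Matrix.transvection a b t) := by
        rw [Matrix.isUnit_iff_isUnit_det, Matrix.det_transvection_of_ne a b hab]
        exact isUnit_one
      have h := congrFun (congrFun (H _ hu) a) j
      have hmap : (Matrix.transvection a b t).map (· ^ p) = Matrix.transvection a b (t ^ p) := by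
        ext i k
        by_cases hik : i = k
        · subst hik
          by_cases hai : a = i
          · subst hai
            simp [Matrix.transvection, Matrix.single, hab.symm]
          · simp [Matrix.transvection, Matrix.single, hai]
        · by_cases hs : a = i ∧ b = k
          · simp [Matrix.transvection, Matrix.single, hik, hs]
          · simp [Matrix.transvection, Matrix.single, hik, hs, hp.ne_zero]
      rw [hmap, Matrix.map_apply, Matrix.transvection_mul_apply_same,
        Matrix.transvection_mul_apply_same, Matrix.map_apply, Matrix.map_apply, hfrob, hfrob] at h
      exact h
    exact ⟨τ, hτ, fun j => ⟨hne j, hfrob _ _⟩⟩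
  · rintro ⟨τ, hτ, hfrob⟩ u -
    ext1 i j
    have hl : (u * v) i j = u i (τ j) * v (τ j) j := by
      rw [Matrix.mul_apply]
      exact Finset.sum_eq_single _ (fun k _ hk => by rw [hτ k j hk, mul_zero]) (by simp)
    have hr : (u.map (· ^ p) * v.map (frobW p)) i j = u i (τ j) ^ p * frobW p (v (τ j) j) := by
      rw [Matrix.mul_apply]
      exact Finset.sum_eq_single (τ j)
        (fun k _ hk => by rw [Matrix.map_apply, Matrix.map_apply, hτ k j hk, map_zero, mul_zero])
        (by simp)
    rw [hr, Matrix.map_apply, hl, (hfrob j).2, mul_pow]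
end
end
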